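/- Let 1 ≤ k ≤ d be integers, let U ⊆ ℝ^k be open, and let Φ: U → ℝ^{d+1} be a C^∞ map. Define f: U^{d+1} → ℝ by f(s_1, …, s_{d+1}) = det[Φ(s_1) ⋯ Φ(s_{d+1})] (the determinant of the (d+1)×(d+1) matrix with columns Φ(s_i)). Then for any multi-indices α_1, …, α_{d+1} ∈ ℕ^k with |α_1| + … + |α_{d+1}| < N_{k,d}, the partial derivative ∂^{α_1}_{s_1} ⋯ ∂^{α_{d+1}}_{s_{d+1}} f vanishes at every point of the diagonal {(t, …, t) : t ∈ U}. In other words, the smallest order of a derivative of f which does not vanish identically along the diagonal is at least N_{k,d}. -/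

import Mathlib

open Set Filter Metric MeasureTheory
noncomputable section

/-- A point of `ℝ^d` is *rational* if all of its coordinates are rational numbers. -/
def IsRatPt {d : ℕ} (x : Fin d → ℝ) : Prop := ∀ i, ∃ a : ℚ, x i = (a : ℝ)

/-- The *height* of a rational point `x ∈ ℚ^d ⊆ ℝ^d`: the least positive integer `q`
with `q • x ∈ ℤ^d`. -/
def ht {d : ℕ} (x : Fin d → ℝ) : ℕ :=
  sInf {q : ℕ | 0 < q ∧ ∀ i, ∃ m : ℤ, (q : ℝ) * x i = (m : ℝ)}

/-- `Ssum k n = [k-1,1] + [k-1,2] + ⋯ + [k-1,n]` where `[n,m] = C(n+m,m)`. -/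
def Ssum (k n : ℕ) : ℕ := ∑ j ∈ Finset.Icc 1 n, Nat.choose (k - 1 + j) j

/-- `nkd k d` is the largest `n ≥ 0` with `[k-1,1] + ⋯ + [k-1,n] ≤ d`. -/
def nkd (k d : ℕ) : ℕ := sSup {n : ℕ | Ssum k n ≤ d}

/-- `mkd k d = d − ([k-1,1] + ⋯ + [k-1,n_{k,d}])`. -/
def mkd (k d : ℕ) : ℕ := d - Ssum k (nkd k d)

/-- `Nkd k d = 1·[k-1,1] + 2·[k-1,2] + ⋯ + n_{k,d}·[k-1,n_{k,d}] + (n_{k,d}+1)·m_{k,d}`. -/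
def Nkd (k d : ℕ) : ℕ :=
  (∑ j ∈ Finset.Icc 1 (nkd k d), j * Nat.choose (k - 1 + j) j) + (nkd k d + 1) * mkd k d

/-- The exponent `c(k,d) = (d+1)/N_{k,d}`. -/
def ckd (k d : ℕ) : ℝ := (d + 1) / (Nkd k d)

/-- Directional derivative operator: `dirD v f x = Df(x)(v)`. -/
def dirD {E F : Type*} [NormedAddCommGroup E] [NormedSpace ℝ E]
    [NormedAddCommGroup F] [NormedSpace ℝ F] (v : E) (f : E → F) : E → F :=
  fun x => fderiv ℝ f x v

/-- Iterated partial derivative `∂^α` with respect to the directions `e i`,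
where direction `e i` is applied `α i` times. -/
def multiD {ι : Type*} [Fintype ι] {E F : Type*} [NormedAddCommGroup E] [NormedSpace ℝ E]
    [NormedAddCommGroup F] [NormedSpace ℝ F] (e : ι → E) (α : ι → ℕ) (f : E → F) : E → F :=
  (Finset.univ : Finset ι).toList.foldr (fun i g => (dirD (e i))^[α i] g) f

/-- The partial derivative `∂^α f` for a multi-index `α ∈ ℕ^k`. -/
def mderiv {k : ℕ} {F : Type*} [NormedAddCommGroup F] [NormedSpace ℝ F]
    (α : Fin k → ℕ) (f : (Fin k → ℝ) → F) : (Fin k → ℝ) → F :=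
  multiD (fun i => Pi.single i (1 : ℝ)) α f

/-- `Φ : U → M` is a `C^∞` local parameterization of the `k`-dimensional submanifold
`M ⊆ ℝ^d`: `U` is open, `Φ` is smooth and injective on `U` with everywhere injective
differential, and `Φ` is a homeomorphism of `U` onto a relatively open subset of `M`. -/
structure IsLocParam (k d : ℕ) (M : Set (Fin d → ℝ)) (U : Set (Fin k → ℝ))
    (Φ : (Fin k → ℝ) → (Fin d → ℝ)) : Prop where
  open_dom : IsOpen U
  smooth : ContDiffOn ℝ (⊤ : ℕ∞) Φ U
  inj : Set.InjOn Φ U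
  maps_to : Φ '' U ⊆ M
  immersion : ∀ v ∈ U, Function.Injective (fderiv ℝ Φ v)
  open_map : ∀ s : Set (Fin k → ℝ), IsOpen s →
    ∃ O : Set (Fin d → ℝ), IsOpen O ∧ Φ '' (s ∩ U) = O ∩ M

/-- `M ⊆ ℝ^d` is a `C^∞` submanifold of dimension `k`. -/
def IsSmoothSubmanifold (k d : ℕ) (M : Set (Fin d → ℝ)) : Prop :=
  ∀ x ∈ M, ∃ (U : Set (Fin k → ℝ)) (Φ : (Fin k → ℝ) → (Fin d → ℝ)),
    IsLocParam k d M U Φ ∧ x ∈ Φ '' U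

/-- `x ∈ M` is `D`-nondegenerate: for some local parameterization `Φ` with `Φ v = x`,
the partial derivatives `∂^α Φ(v)`, `0 < |α| ≤ D`, span `ℝ^d`. -/
def IsNondegAt (k d D : ℕ) (M : Set (Fin d → ℝ)) (x : Fin d → ℝ) : Prop :=
  ∃ (U : Set (Fin k → ℝ)) (Φ : (Fin k → ℝ) → (Fin d → ℝ)) (v : Fin k → ℝ),
    IsLocParam k d M U Φ ∧ v ∈ U ∧ Φ v = x ∧
    Submodule.span ℝ {y : Fin d → ℝ | ∃ α : Fin k → ℕ,
      0 < (∑ j, α j) ∧ (∑ j, α j) ≤ D ∧ y = mderiv α Φ v} = ⊤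

/-- `x ∈ M` is nondegenerate if it is `D`-nondegenerate for some `D`. -/
def IsNondeg (k d : ℕ) (M : Set (Fin d → ℝ)) (x : Fin d → ℝ) : Prop :=
  ∃ D : ℕ, IsNondegAt k d D M x

/-- The set `BA_M(ψ_c)` of `ψ_c`-badly intrinsically approximable points of `M`. -/
def BAset {d : ℕ} (M : Set (Fin d → ℝ)) (c : ℝ) : Set (Fin d → ℝ) :=
  {x ∈ M | ∃ κ > (0 : ℝ), ∀ r : Fin d → ℝ, IsRatPt r → r ∈ M →
    κ * (ht r : ℝ) ^ (-c) ≤ ‖x - r‖}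

/-- The set `VWA_M(ψ_c)` of `ψ_c`-very well intrinsically approximable points of `M`. -/
def VWAset {d : ℕ} (M : Set (Fin d → ℝ)) (c : ℝ) : Set (Fin d → ℝ) :=
  {x ∈ M | ∃ ε > (0 : ℝ),
    {r : Fin d → ℝ | IsRatPt r ∧ r ∈ M ∧ ‖x - r‖ ≤ (ht r : ℝ) ^ (-(c + ε))}.Infinite}

/-- `ψ` is a Dirichlet function for intrinsic approximation on `S ⊆ ℝ^m`. -/
def IsDirichletFn {m : ℕ} (S : Set (Fin m → ℝ)) (ψ : ℝ → ℝ) : Prop :=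
  (∀ t : ℝ, 0 < t → 0 < ψ t) ∧
  ∀ x ∈ S, ∃ C > (0 : ℝ), ∃ r : ℕ → (Fin m → ℝ),
    (∀ n, IsRatPt (r n) ∧ r n ∈ S) ∧ Filter.Tendsto r Filter.atTop (nhds x) ∧
    ∀ n, ‖x - r n‖ ≤ C * ψ (ht (r n))

/-- The closed `t`-neighborhood `S^{(t)}` of a set `S`. -/
def cnbhd {E : Type*} [PseudoMetricSpace E] (S : Set E) (t : ℝ) : Set E :=
  {x | ∃ y ∈ S, dist x y ≤ t}

/-- `x` belongs to the (topological) support of the measure `μ`. -/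
def InSupp {k : ℕ} (μ : Measure (Fin k → ℝ)) (x : Fin k → ℝ) : Prop :=
  ∀ ρ > (0 : ℝ), 0 < μ (ball x ρ)

/-- `μ` is absolutely decaying on `U`. -/
def AbsolutelyDecaying {k : ℕ} (μ : Measure (Fin k → ℝ)) (U : Set (Fin k → ℝ)) : Prop :=
  ∃ C > (0 : ℝ), ∃ a > (0 : ℝ), ∀ x, InSupp μ x → ∀ ρ : ℝ, 0 < ρ → ρ ≤ 1 →
    closedBall x ρ ⊆ U → ∀ ε > (0 : ℝ), ∀ (w : Fin k → ℝ) (b : ℝ), w ≠ 0 →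
      μ (cnbhd {y : Fin k → ℝ | ∑ j, w j * y j = b} (ε * ρ) ∩ closedBall x ρ) ≤
        ENNReal.ofReal (C * ε ^ a) * μ (closedBall x ρ)

/-- `μ` is doubling. -/
def IsDoubling {k : ℕ} (μ : Measure (Fin k → ℝ)) : Prop :=
  ∃ C > (0 : ℝ), ∀ x, InSupp μ x → ∀ ρ : ℝ, 0 < ρ → ρ ≤ 1 →
    μ (closedBall x (2 * ρ)) ≤ ENNReal.ofReal C * μ (closedBall x ρ)

/-- `μ` is absolutely friendly on `U`: absolutely decaying and doubling. -/
def AbsolutelyFriendly {k : ℕ} (μ : Measure (Fin k → ℝ)) (U : Set (Fin k → ℝ)) : Prop :=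
  AbsolutelyDecaying μ U ∧ IsDoubling μ

/-- The class `P_D` of polynomials of degree at most `D` whose coefficient of largest
absolute value has absolute value exactly `1`. -/
def IsPD (k D : ℕ) (p : MvPolynomial (Fin k) ℝ) : Prop :=
  p.totalDegree ≤ D ∧ (∀ m, |p.coeff m| ≤ 1) ∧ ∃ m, |p.coeff m| = 1

/-- Partial derivative within a set `s`, in the `i`-th coordinate direction. -/
def pderivW {k : ℕ} (s : Set (Fin k → ℝ)) (i : Fin k) (f : (Fin k → ℝ) → ℝ) :
    (Fin k → ℝ) → ℝ :=
  fun x => fderivWithin ℝ f s x (Pi.single i 1)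

/-- Iterated partial derivative `∂^α f` within a set `s`. -/
def mderivW {k : ℕ} (s : Set (Fin k → ℝ)) (α : Fin k → ℕ) (f : (Fin k → ℝ) → ℝ) :
    (Fin k → ℝ) → ℝ :=
  (List.finRange k).foldr (fun i g => (pderivW s i)^[α i] g) f

/-- The `C^D` norm `‖f‖_{C^D,B}` of `f` on `B`. -/
def CDnorm {k : ℕ} (D : ℕ) (B : Set (Fin k → ℝ)) (f : (Fin k → ℝ) → ℝ) : ℝ :=
  sSup {y : ℝ | ∃ α : Fin k → ℕ, (∑ j, α j) ≤ D ∧ ∃ x ∈ B, y = |mderivW B α f x|}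

/-- Analytic local parameterization. -/
structure IsAnalLocParam (k d : ℕ) (M : Set (Fin d → ℝ)) (U : Set (Fin k → ℝ))
    (Φ : (Fin k → ℝ) → (Fin d → ℝ)) : Prop where
  open_dom : IsOpen U
  analytic : AnalyticOnNhd ℝ Φ U
  inj : Set.InjOn Φ U
  maps_to : Φ '' U ⊆ M
  immersion : ∀ v ∈ U, Function.Injective (fderiv ℝ Φ v)
  open_map : ∀ s : Set (Fin k → ℝ), IsOpen s →
    ∃ O : Set (Fin d → ℝ), IsOpen O ∧ Φ '' (s ∩ U) = O ∩ M

/-- `M ⊆ ℝ^d` is a real-analytic submanifold of dimension `k`. -/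
def IsAnalSubmanifold (k d : ℕ) (M : Set (Fin d → ℝ)) : Prop :=
  ∀ x ∈ M, ∃ (U : Set (Fin k → ℝ)) (Φ : (Fin k → ℝ) → (Fin d → ℝ)),
    IsAnalLocParam k d M U Φ ∧ x ∈ Φ '' U

/-- `D`-nondegeneracy via an analytic local parameterization. -/
def IsAnalNondegAt (k d D : ℕ) (M : Set (Fin d → ℝ)) (x : Fin d → ℝ) : Prop :=
  ∃ (U : Set (Fin k → ℝ)) (Φ : (Fin k → ℝ) → (Fin d → ℝ)) (v : Fin k → ℝ),
    IsAnalLocParam k d M U Φ ∧ v ∈ U ∧ Φ v = x ∧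
    Submodule.span ℝ {y : Fin d → ℝ | ∃ α : Fin k → ℕ,
      0 < (∑ j, α j) ∧ (∑ j, α j) ≤ D ∧ y = mderiv α Φ v} = ⊤

/-- Nondegeneracy via an analytic local parameterization. -/
def IsAnalNondeg (k d : ℕ) (M : Set (Fin d → ℝ)) (x : Fin d → ℝ) : Prop :=
  ∃ D : ℕ, IsAnalNondegAt k d D M x
/-- The iterated directional derivative along a word of directions. -/
def wordD {ι E F : Type*} [NormedAddCommGroup E] [NormedSpace ℝ E]
    [NormedAddCommGroup F] [NormedSpace ℝ F] (e : ι → E) (w : List ι) (f : E → F) : E → F :=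
  w.foldr (fun i g => dirD (e i) g) f

section Calculus

variable {ι E F : Type*} [NormedAddCommGroup E] [NormedSpace ℝ E]
  [NormedAddCommGroup F] [NormedSpace ℝ F]

lemma wordD_cons (e : ι → E) (i : ι) (w : List ι) (f : E → F) :
    wordD e (i :: w) f = dirD (e i) (wordD e w f) := rfl

lemma wordD_append (e : ι → E) (v w : List ι) (f : E → F) :
    wordD e (v ++ w) f = wordD e v (wordD e w f) := by
  simp [wordD]

lemma wordD_replicate (e : ι → E) (i : ι) (n : ℕ) (f : E → F) :
    wordD e (List.replicate n i) f = (dirD (e i))^[n] f := by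
  induction n with
  | zero => rfl
  | succ n ih => rw [List.replicate_succ, wordD_cons, ih, Function.iterate_succ_apply']

lemma multiD_eq_wordD [Fintype ι] (e : ι → E) (α : ι → ℕ) (f : E → F) :
    multiD e α f =
      wordD e ((Finset.univ : Finset ι).toList.flatMap fun i => List.replicate (α i) i) f := by
  unfold multiD
  induction (Finset.univ : Finset ι).toList with
  | nil => rfl
  | cons i l ih =>
    rw [List.foldr_cons, List.flatMap_cons, wordD_append, ih, wordD_replicate]

lemma count_flatMap_replicate [Fintype ι] [BEq ι] [LawfulBEq ι] (α : ι → ℕ) (i : ι) :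
    ((Finset.univ : Finset ι).toList.flatMap fun i => List.replicate (α i) i).count i = α i := by
  classical
  rw [List.count_flatMap]
  have : (List.count i ∘ fun j => List.replicate (α j) j) = fun j => if j = i then α j else 0 := by
    funext j
    simp [List.count_replicate]
  rw [this, Finset.sum_map_toList]
  simp

lemma ContDiffOn.dirD {U : Set E} (hU : IsOpen U) {f : E → F}
    (hf : ContDiffOn ℝ (⊤ : ℕ∞) f U) (v : E) : ContDiffOn ℝ (⊤ : ℕ∞) (dirD v f) U :=
  (hf.fderiv_of_isOpen hU (by simp)).clm_apply contDiffOn_const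

lemma ContDiffOn.wordD {U : Set E} (hU : IsOpen U) {f : E → F}
    (hf : ContDiffOn ℝ (⊤ : ℕ∞) f U) (e : ι → E) (w : List ι) :
    ContDiffOn ℝ (⊤ : ℕ∞) (wordD e w f) U := by
  induction w with
  | nil => exact hf
  | cons i w ih => exact ih.dirD hU (e i)

lemma Set.EqOn.dirD {U : Set E} (hU : IsOpen U) {f g : E → F} (h : EqOn f g U) (v : E) :
    EqOn (dirD v f) (dirD v g) U := fun x hx => by
  simp only [_root_.dirD, (h.eventuallyEq_of_mem (hU.mem_nhds hx)).fderiv_eq]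

lemma dirD_comm {U : Set E} (hU : IsOpen U) {f : E → F}
    (hf : ContDiffOn ℝ (⊤ : ℕ∞) f U) (v w : E) :
    EqOn (dirD v (dirD w f)) (dirD w (dirD v f)) U := fun x hx => by
  have hc : ContDiffAt ℝ (⊤ : ℕ∞) f x := hf.contDiffAt (hU.mem_nhds hx)
  have hd : DifferentiableAt ℝ (fderiv ℝ f) x :=
    (hc.fderiv_right (m := 1) (by norm_cast)).differentiableAt (by simp)
  have key : ∀ a b : E, dirD a (dirD b f) x = fderiv ℝ (fderiv ℝ f) x a b := fun a b => by
    unfold dirD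
    rw [fderiv_clm_apply hd (differentiableAt_const b)]
    simp
  rw [key, key]
  refine hc.isSymmSndFDerivAt ?_ v w
  rw [minSmoothness_of_isRCLikeNormedField]
  exact WithTop.coe_le_coe.2 (le_top : (2 : ℕ∞) ≤ ⊤)

lemma wordD_eqOn_of_perm {U : Set E} (hU : IsOpen U) {f : E → F}
    (hf : ContDiffOn ℝ (⊤ : ℕ∞) f U) (e : ι → E) {v w : List ι} (h : v.Perm w) :
    EqOn (wordD e v f) (wordD e w f) U := by
  induction h with
  | nil => exact fun _ _ => rfl
  | cons i _ ih => exact ih.dirD hU (e i)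
  | swap i j l => exact dirD_comm hU (hf.wordD hU e l) (e j) (e i)
  | trans _ _ ih₁ ih₂ => exact ih₁.trans ih₂

end Calculus

/-- The letters of `w` that act on the `j`-th variable. -/
def wordAt {n ι : Type*} [DecidableEq n] (w : List (n × ι)) (j : n) : List ι :=
  (w.filter fun q => q.1 = j).map Prod.snd

lemma count_wordAt {n ι : Type*} [DecidableEq n] [DecidableEq ι] (w : List (n × ι)) (j : n) (l : ι) :
    (wordAt w j).count l = w.count (j, l) := by
  induction w with
  | nil => rfl
  | cons q w ih =>
    obtain ⟨a, b⟩ := q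
    unfold wordAt at ih ⊢
    by_cases h : a = j <;> simp [List.count_cons, h, ih]

section Determinant

variable {n E : Type*} [Fintype n] [DecidableEq n] [NormedAddCommGroup E] [NormedSpace ℝ E]

lemma dirD_det {Ψ : n → E → n → ℝ} {s : n → E} (hΨ : ∀ j, DifferentiableAt ℝ (Ψ j) (s j))
    (p : n) (v : E) :
    dirD (Pi.single p v) (fun s : n → E => Matrix.det (Matrix.of fun i j => Ψ j (s j) i)) s =
      Matrix.det (Matrix.of fun i j => Function.update Ψ p (dirD v (Ψ p)) j (s j) i) := by
  set G : (n → E) → ℝ := fun s => Matrix.det (Matrix.of fun i j => Ψ j (s j) i) with hG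
  set M : Matrix n n ℝ := Matrix.of fun i j => Ψ j (s j) i with hM
  have hGd : DifferentiableAt ℝ G s := by
    have hentry : ∀ i j, DifferentiableAt ℝ (fun s : n → E => Ψ j (s j) i) s := fun i j =>
      (differentiableAt_pi.1 ((hΨ j).comp s (differentiableAt_apply j s)) i)
    simp only [hG, Matrix.det_apply, Matrix.of_apply]
    exact DifferentiableAt.fun_sum fun σ _ =>
      (HasFDerivAt.finsetProd fun i _ =>
        (hentry (σ i) i).hasFDerivAt).differentiableAt.const_smul _
  let L : (n → ℝ) →L[ℝ] ℝ :=
    LinearMap.toContinuousLinearMap (LinearMap.proj p ∘ₗ Matrix.cramer M)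
  have hL : ∀ b, L b = (M.updateCol p b).det := fun b => rfl
  have hcomp : G ∘ Function.update s p = fun x => L (Ψ p x) := by
    funext x
    rw [hL]
    simp only [hG, Function.comp_apply]
    congr 1
    ext i j
    by_cases h : j = p
    · subst h; simp
    · simp [h, hM]
  have h1 : HasFDerivAt (G ∘ Function.update s p)
      ((fderiv ℝ G s).comp (.pi (Pi.single p (.id ℝ E)))) (s p) := by
    refine HasFDerivAt.comp (s p) ?_ (hasFDerivAt_update s (s p))
    simpa using hGd.hasFDerivAt
  have h2 : HasFDerivAt (fun x => L (Ψ p x)) (L.comp (fderiv ℝ (Ψ p) (s p))) (s p) :=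
    L.hasFDerivAt.comp (s p) (hΨ p).hasFDerivAt
  have h3 := congrArg (fun T => T v) (h1.unique (hcomp ▸ h2))
  have h4 : (ContinuousLinearMap.pi (Pi.single p (.id ℝ E)) : E →L[ℝ] n → E) v =
      Pi.single p v := by
    funext j
    by_cases h : j = p
    · subst h; simp
    · simp [h]
  simp only [ContinuousLinearMap.comp_apply, h4, hL] at h3
  refine h3.trans ?_
  congr 1
  ext i j
  by_cases h : j = p
  · subst h; simp [dirD]
  · simp [h, hM]

lemma wordD_det {ι : Type*} {U : Set E} (hU : IsOpen U) {Φ : E → n → ℝ}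
    (hΦ : ContDiffOn ℝ (⊤ : ℕ∞) Φ U) (e : ι → E) (w : List (n × ι)) :
    EqOn (wordD (fun p : n × ι => (Pi.single p.1 (e p.2) : n → E)) w
        (fun s => Matrix.det (Matrix.of fun i j => Φ (s j) i)))
      (fun s => Matrix.det (Matrix.of fun i j => wordD e (wordAt w j) Φ (s j) i))
      (Set.univ.pi fun _ => U) := by
  induction w with
  | nil => exact fun _ _ => rfl
  | cons q w ih =>
    intro s hs
    rw [wordD_cons, ih.dirD (isOpen_set_pi Set.finite_univ fun _ _ => hU) _ hs,
      dirD_det fun j => ((hΦ.wordD hU e _).contDiffAt (hU.mem_nhds (hs j trivial))).differentiableAt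
        (by simp)]
    congr 1
    ext i j
    by_cases h : j = q.1
    · subst h; simp [wordAt, wordD_cons]
    · simp [h, wordAt, Ne.symm h]

end Determinant

section Counting

lemma card_piAntidiag_univ_fin {k : ℕ} (hk : 1 ≤ k) (n : ℕ) :
    (Finset.piAntidiag (Finset.univ : Finset (Fin k)) n).card = (k - 1 + n).choose n := by
  rw [← Finset.map_sym_eq_piAntidiag, Finset.card_map, Finset.sym_univ, Finset.card_univ,
    Sym.card_sym_eq_choose, Fintype.card_fin, Nat.sub_add_comm hk]

lemma Ssum_nkd_le (k d : ℕ) : Ssum k (nkd k d) ≤ d := by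
  refine Nat.sSup_mem (s := {n : ℕ | Ssum k n ≤ d}) ⟨0, by simp [Ssum]⟩ ⟨d, fun n hn => ?_⟩
  calc n = ∑ _j ∈ Finset.Icc 1 n, 1 := by simp
    _ ≤ Ssum k n := Finset.sum_le_sum fun j _ => Nat.choose_pos (Nat.le_add_left j _)
    _ ≤ d := hn

lemma Nkd_add_sum (k d : ℕ) :
    Nkd k d + ∑ j ∈ Finset.range (nkd k d + 1), (nkd k d + 1 - j) * (k - 1 + j).choose j =
      (nkd k d + 1) * (d + 1) := by
  obtain ⟨m, hm⟩ := Nat.exists_eq_add_of_le (Ssum_nkd_le k d)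
  have hmkd : mkd k d = m := by unfold mkd; omega
  unfold Nkd
  rw [hmkd]
  generalize nkd k d = n at *
  have h0 : ∑ j ∈ Finset.range (n + 1), (n + 1 - j) * (k - 1 + j).choose j =
      (n + 1) + ∑ j ∈ Finset.Icc 1 n, (n + 1 - j) * (k - 1 + j).choose j := by
    rw [Finset.range_eq_Ico, Finset.sum_eq_sum_Ico_succ_bot (Nat.succ_pos n)]
    simp [Finset.Ico_add_one_right_eq_Icc]
  have h1 : ∑ j ∈ Finset.Icc 1 n, j * (k - 1 + j).choose j +
      ∑ j ∈ Finset.Icc 1 n, (n + 1 - j) * (k - 1 + j).choose j = (n + 1) * Ssum k n := by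
    rw [← Finset.sum_add_distrib, Ssum, Finset.mul_sum]
    refine Finset.sum_congr rfl fun j hj => ?_
    rw [← add_mul, Nat.add_sub_of_le (by have := (Finset.mem_Icc.1 hj).2; omega)]
  rw [h0]
  calc _ = (∑ j ∈ Finset.Icc 1 n, j * (k - 1 + j).choose j +
      ∑ j ∈ Finset.Icc 1 n, (n + 1 - j) * (k - 1 + j).choose j) + (n + 1) * (m + 1) := by ring
    _ = (n + 1) * (d + 1) := by rw [h1, hm]; ring

lemma sum_tsub_le_of_injective {ι : Type*} [Fintype ι] {k : ℕ} (hk : 1 ≤ k)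
    {A : ι → Fin k → ℕ} (hA : Function.Injective A) (N : ℕ) :
    ∑ i, (N - ∑ l, A i l) ≤ ∑ j ∈ Finset.range N, (N - j) * (k - 1 + j).choose j := by
  classical
  let T := (Finset.univ : Finset ι).filter fun i => ∑ l, A i l < N
  have hT : ∑ i, (N - ∑ l, A i l) = ∑ i ∈ T, (N - ∑ l, A i l) := by
    refine (Finset.sum_subset (Finset.filter_subset _ _) fun i _ hi => ?_).symm
    simp only [Finset.mem_filter, Finset.mem_univ, true_and, not_lt] at hi
    exact Nat.sub_eq_zero_of_le hi
  rw [hT, ← Finset.sum_fiberwise_of_maps_to (t := Finset.range N) (g := fun i => ∑ l, A i l)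
    (fun i hi => Finset.mem_range.2 (Finset.mem_filter.1 hi).2)]
  refine Finset.sum_le_sum fun j _ => ?_
  rw [Finset.sum_congr rfl fun i hi => by rw [(Finset.mem_filter.1 hi).2], Finset.sum_const,
    smul_eq_mul, mul_comm, ← card_piAntidiag_univ_fin hk]
  refine Nat.mul_le_mul_left _ (Finset.card_le_card_of_injOn A (fun i hi => ?_) hA.injOn)
  simpa using (Finset.mem_filter.1 hi).2

lemma Nkd_le_sum_of_injective {k d : ℕ} (hk : 1 ≤ k) {A : Fin (d + 1) → Fin k → ℕ}
    (hA : Function.Injective A) : Nkd k d ≤ ∑ i, ∑ l, A i l := by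
  have h1 := Nkd_add_sum k d
  have h2 := sum_tsub_le_of_injective hk hA (nkd k d + 1)
  have h3 : (nkd k d + 1) * (d + 1) ≤
      ∑ i, (nkd k d + 1 - ∑ l, A i l) + ∑ i, ∑ l, A i l := by
    rw [← Finset.sum_add_distrib]
    calc (nkd k d + 1) * (d + 1) = ∑ _i : Fin (d + 1), (nkd k d + 1) := by simp [mul_comm]
      _ ≤ _ := Finset.sum_le_sum fun i _ => le_tsub_add
  omega

end Counting

/-- **Claim (vanishing of low-order derivatives of the determinant on the diagonal).**
With `f(s_1,…,s_{d+1}) = det[Φ(s_1) ⋯ Φ(s_{d+1})]` for a `C^∞` map `Φ : U → ℝ^{d+1}`,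
every partial derivative `∂^{α_1}_{s_1}⋯∂^{α_{d+1}}_{s_{d+1}} f` of total order
`< N_{k,d}` vanishes at every point of the diagonal. -/
theorem derivative_vanishing_on_diagonal (k d : ℕ) (hk : 1 ≤ k) (hkd : k ≤ d)
    (U : Set (Fin k → ℝ)) (hU : IsOpen U)
    (Φ : (Fin k → ℝ) → (Fin (d + 1) → ℝ)) (hΦ : ContDiffOn ℝ (⊤ : ℕ∞) Φ U)
    (A : Fin (d + 1) → Fin k → ℕ) (hA : (∑ i, ∑ j, A i j) < Nkd k d)
    (t : Fin k → ℝ) (htU : t ∈ U) :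
    multiD (fun p : Fin (d + 1) × Fin k => Pi.single p.1 (Pi.single p.2 (1 : ℝ)))
      (fun p : Fin (d + 1) × Fin k => A p.1 p.2)
      (fun s : Fin (d + 1) → Fin k → ℝ => Matrix.det (Matrix.of fun i j => Φ (s j) i))
      (fun _ => t) = 0 := by
  obtain ⟨a, b, hab, hne⟩ : ∃ a b, A a = A b ∧ a ≠ b := by
    by_contra! h
    exact absurd hA (Nkd_le_sum_of_injective hk h).not_gt
  rw [multiD_eq_wordD]
  set w := (Finset.univ : Finset (Fin (d + 1) × Fin k)).toList.flatMap
    fun p => List.replicate (A p.1 p.2) p with hw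
  have hcount : ∀ j l, (wordAt w j).count l = A j l := fun j l => by
    rw [count_wordAt, hw]
    exact count_flatMap_replicate (fun p : Fin (d + 1) × Fin k => A p.1 p.2) (j, l)
  have hperm : (wordAt w a).Perm (wordAt w b) :=
    List.perm_iff_count.2 fun l => by rw [hcount, hcount, hab]
  refine (wordD_det hU hΦ (fun l : Fin k => (Pi.single l (1 : ℝ) : Fin k → ℝ)) w
    (fun _ _ => htU : (fun _ : Fin (d + 1) => t) ∈ Set.univ.pi fun _ => U)).trans ?_
  exact Matrix.det_zero_of_column_eq hne fun i =>
    congrFun (wordD_eqOn_of_perm hU hΦ _ hperm htU) i
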